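/- Let M be a complete Riemannian n-manifold with ∇²Ric ≡ 0. If there exists a constant ρ such that Ric_q(w,w) ≤ ρ for all q ∈ M and all unit vectors w ∈ T_qM (i.e. the Ricci curvature is bounded above on M), then the Ricci tensor of M is parallel: ∇Ric ≡ 0. -/

import Mathlib

open scoped ENNReal RealInnerProductSpace

/-- Abstract data of a complete Riemannian `n`-manifold.  The tangent space at every
point is modeled on `EuclideanSpace ℝ (Fin n)` (via a parallel orthonormal frame), and we
record: the (normalized) Ricci tensor `ric`, the geodesic `geod p v` with `γ(0) = p`,
`γ'(0) = v`, parallel transport `partrans p v t` along this geodesic from time `0` to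
time `t` (so that `γ'(t) = partrans p v t v`), the distance `cutDist p` from `p` to its
cut locus `C(p)`, and the first and second covariant derivatives `nablaRic`, `nabla2Ric`
of the Ricci tensor, characterized by differentiation along geodesics through parallel
vector fields. -/
structure RiemannianManifoldData (n : ℕ) where
  /-- the underlying space of the manifold -/
  M : Type
  [met : MetricSpace M]
  [complete : CompleteSpace M]
  /-- the normalized Ricci tensor `Ric_p(x, y)` -/
  ric : M → EuclideanSpace ℝ (Fin n) → EuclideanSpace ℝ (Fin n) → ℝ
  ric_symm : ∀ p x y, ric p x y = ric p y x
  ric_add : ∀ p x y z, ric p (x + y) z = ric p x z + ric p y z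
  ric_smul : ∀ p (c : ℝ) x y, ric p (c • x) y = c * ric p x y
  /-- the geodesic with `γ(0) = p` and `γ'(0) = v` -/
  geod : M → EuclideanSpace ℝ (Fin n) → ℝ → M
  geod_zero : ∀ p v, geod p v 0 = p
  /-- parallel transport along the geodesic `geod p v` from time `0` to time `t` -/
  partrans : M → EuclideanSpace ℝ (Fin n) → ℝ →
      (EuclideanSpace ℝ (Fin n) ≃ₗᵢ[ℝ] EuclideanSpace ℝ (Fin n))
  partrans_zero : ∀ p v, partrans p v 0 = LinearIsometryEquiv.refl ℝ _
  /-- the distance `d(p, C(p))` from `p` to its cut locus, possibly infinite -/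
  cutDist : M → ℝ≥0∞
  cutDist_pos : ∀ p, 0 < cutDist p
  /-- unit-speed geodesics are minimizing before the cut locus -/
  minimizing : ∀ p v, ‖v‖ = 1 → ∀ t : ℝ, 0 ≤ t → ENNReal.ofReal t < cutDist p →
      dist p (geod p v t) = t
  /-- the covariant derivative `∇Ric` of the Ricci tensor, `∇Ric_p(w, x, y)` -/
  nablaRic : M → EuclideanSpace ℝ (Fin n) → EuclideanSpace ℝ (Fin n) →
      EuclideanSpace ℝ (Fin n) → ℝ
  /-- the second covariant derivative `∇²Ric = ∇(∇Ric)` of the Ricci tensor -/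
  nabla2Ric : M → EuclideanSpace ℝ (Fin n) → EuclideanSpace ℝ (Fin n) →
      EuclideanSpace ℝ (Fin n) → EuclideanSpace ℝ (Fin n) → ℝ
  /-- `∇Ric` differentiates `Ric` along geodesics through parallel vector fields -/
  hasDerivAt_ric : ∀ p v x y (t : ℝ),
      HasDerivAt (fun s => ric (geod p v s) (partrans p v s x) (partrans p v s y))
        (nablaRic (geod p v t) (partrans p v t v) (partrans p v t x) (partrans p v t y)) t
  /-- `∇²Ric` differentiates `∇Ric` along geodesics through parallel vector fields -/
  hasDerivAt_nablaRic : ∀ p v w x y (t : ℝ),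
      HasDerivAt
        (fun s => nablaRic (geod p v s) (partrans p v s w) (partrans p v s x)
          (partrans p v s y))
        (nabla2Ric (geod p v t) (partrans p v t v) (partrans p v t w) (partrans p v t x)
          (partrans p v t y)) t

attribute [instance] RiemannianManifoldData.met RiemannianManifoldData.complete

/-- The injectivity radius `i(M) = inf_{p ∈ M} d(p, C(p))`. -/
noncomputable def RiemannianManifoldData.injRad {n : ℕ} (S : RiemannianManifoldData n) :
    ℝ≥0∞ :=
  ⨅ p : S.M, S.cutDist p

/-- The set of Ricci curvatures `Ric_q(w, w)` over the unit tangent bundle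
`T₁M = {(q, w) : q ∈ M, w ∈ T_qM, ‖w‖ = 1}`. -/
def RiemannianManifoldData.ricciSet {n : ℕ} (S : RiemannianManifoldData n) : Set ℝ :=
  {r : ℝ | ∃ (q : S.M) (w : EuclideanSpace ℝ (Fin n)), ‖w‖ = 1 ∧ r = S.ric q w w}

namespace RiemannianManifoldData

variable {n : ℕ} (S : RiemannianManifoldData n)

theorem ric_add_right (p : S.M) (x y z : EuclideanSpace ℝ (Fin n)) :
    S.ric p x (y + z) = S.ric p x y + S.ric p x z := by
  rw [S.ric_symm, S.ric_add, S.ric_symm p y, S.ric_symm p z]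

theorem ric_smul_right (p : S.M) (c : ℝ) (x y : EuclideanSpace ℝ (Fin n)) :
    S.ric p x (c • y) = c * S.ric p x y := by
  rw [S.ric_symm, S.ric_smul, S.ric_symm p y]

/-- A bound on the Ricci curvature of unit vectors bounds the quadratic form on all vectors. -/
theorem ric_self_le {ρ : ℝ}
    (hρ : ∀ (q : S.M) (w : EuclideanSpace ℝ (Fin n)), ‖w‖ = 1 → S.ric q w w ≤ ρ)
    (q : S.M) (w : EuclideanSpace ℝ (Fin n)) : S.ric q w w ≤ ‖w‖ ^ 2 * ρ := by
  rcases eq_or_ne w 0 with rfl | hw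
  · have h := S.ric_smul q 0 0 0
    simp_all
  · have hn : ‖w‖ ≠ 0 := norm_ne_zero_iff.mpr hw
    have h := hρ q (‖w‖⁻¹ • w) (by rw [norm_smul, norm_inv, norm_norm, inv_mul_cancel₀ hn])
    calc S.ric q w w = ‖w‖ ^ 2 * S.ric q (‖w‖⁻¹ • w) (‖w‖⁻¹ • w) := by
          rw [S.ric_smul, S.ric_smul_right]
          field_simp
      _ ≤ ‖w‖ ^ 2 * ρ := by gcongr

/-- If `∇²Ric ≡ 0`, then `∇Ric` is constant along geodesics on parallel fields. -/
theorem nablaRic_partrans_eq (h2 : ∀ p w x y z, S.nabla2Ric p w x y z = 0)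
    (p : S.M) (v w x y : EuclideanSpace ℝ (Fin n)) (t : ℝ) :
    S.nablaRic (S.geod p v t) (S.partrans p v t w) (S.partrans p v t x) (S.partrans p v t y) =
      S.nablaRic p w x y := by
  have hd := S.hasDerivAt_nablaRic p v w x y
  have h := is_const_of_deriv_eq_zero (fun s => (hd s).differentiableAt)
    (fun s => (hd s).deriv.trans (h2 _ _ _ _ _)) t 0
  simpa [S.geod_zero, S.partrans_zero] using h

/-- If `∇²Ric ≡ 0`, then `Ric` is affine along geodesics on parallel fields. -/
theorem ric_partrans_eq (h2 : ∀ p w x y z, S.nabla2Ric p w x y z = 0)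
    (p : S.M) (v x y : EuclideanSpace ℝ (Fin n)) (t : ℝ) :
    S.ric (S.geod p v t) (S.partrans p v t x) (S.partrans p v t y) =
      S.ric p x y + t * S.nablaRic p v x y := by
  have hd : ∀ s, HasDerivAt (fun s => S.ric (S.geod p v s) (S.partrans p v s x)
      (S.partrans p v s y) - s * S.nablaRic p v x y) 0 s := fun s => by
    have h := (S.hasDerivAt_ric p v x y s).sub
      ((hasDerivAt_id s).mul_const (S.nablaRic p v x y))
    rw [S.nablaRic_partrans_eq h2, one_mul, sub_self] at h
    exact h
  have h := is_const_of_deriv_eq_zero (fun s => (hd s).differentiableAt)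
    (fun s => (hd s).deriv) t 0
  simp only [S.geod_zero, S.partrans_zero, LinearIsometryEquiv.coe_refl, id_eq, zero_mul,
    sub_zero] at h
  linarith

/-- If `∇²Ric ≡ 0` and the Ricci curvature is bounded above, then `∇Ric` vanishes on the diagonal:
along a geodesic `Ric` is an affine function bounded above, hence constant. -/
theorem nablaRic_self_eq_zero (h2 : ∀ p w x y z, S.nabla2Ric p w x y z = 0) {ρ : ℝ}
    (hρ : ∀ (q : S.M) (w : EuclideanSpace ℝ (Fin n)), ‖w‖ = 1 → S.ric q w w ≤ ρ)
    (p : S.M) (v x : EuclideanSpace ℝ (Fin n)) : S.nablaRic p v x x = 0 := by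
  by_contra hc
  set c := S.nablaRic p v x x with hc_def
  have h := S.ric_self_le hρ (S.geod p v ((‖x‖ ^ 2 * ρ - S.ric p x x + 1) / c))
    (S.partrans p v ((‖x‖ ^ 2 * ρ - S.ric p x x + 1) / c) x)
  rw [S.ric_partrans_eq h2, LinearIsometryEquiv.norm_map, ← hc_def, div_mul_cancel₀ _ hc] at h
  linarith

end RiemannianManifoldData

/-- If `M` is a complete Riemannian `n`-manifold with `∇²Ric ≡ 0` whose Ricci curvature
is bounded above by some constant `ρ`, then the Ricci tensor of `M` is parallel:
`∇Ric ≡ 0`. -/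
theorem nablaRic_eq_zero_of_ricci_bddAbove {n : ℕ} (S : RiemannianManifoldData n)
    (h2 : ∀ p w x y z, S.nabla2Ric p w x y z = 0)
    (hbd : ∃ ρ : ℝ, ∀ (q : S.M) (w : EuclideanSpace ℝ (Fin n)), ‖w‖ = 1 → S.ric q w w ≤ ρ) :
    ∀ (p : S.M) (x y z : EuclideanSpace ℝ (Fin n)), S.nablaRic p x y z = 0 := by
  obtain ⟨ρ, hρ⟩ := hbd
  intro p v x y
  have hself := S.nablaRic_self_eq_zero h2 hρ p v
  have hsymm : S.nablaRic p v y x = S.nablaRic p v x y := by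
    have h := S.ric_partrans_eq h2 p v y x 1
    rw [S.ric_symm, S.ric_partrans_eq h2, S.ric_symm p y] at h
    linarith
  have hxy := S.ric_partrans_eq h2 p v (x + y) (x + y) 1
  simp only [map_add, hself, hsymm, S.ric_add, S.ric_add_right, S.ric_partrans_eq h2,
    S.ric_symm p y x] at hxy
  linarith
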